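/- Let π be a ∗-representation of X on a complex Hilbert space H. Then for each k = 1,…,d, the operator π(x_{k0}) vanishes on ker(π(y₀) − α^{-1}·I), i.e. π(x_{k0})φ = 0 whenever π(y₀)φ = α^{-1}φ. -/

import Mathlib

noncomputable section

/-- The Hilbert space `ℓ²(ℕ^d)`. -/
abbrev L2 (d : ℕ) := lp (fun _ : Fin d → ℕ => ℂ) 2

/-- Bounded operators on `ℓ²(ℕ^d)`. -/
abbrev BdOp (d : ℕ) := L2 d →L[ℂ] L2 d

/-- The standard basis vector `e_𝔫` of `ℓ²(ℕ^d)`. -/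
def e2 (d : ℕ) (n : Fin d → ℕ) : L2 d := lp.single 2 n (1 : ℂ)

/-- The total degree `|𝔫| = n₁ + ⋯ + n_d`. -/
def degIdx (d : ℕ) (n : Fin d → ℕ) : ℕ := ∑ k, n k

/-- The multi-index resulting from applying `a_k` (`k > 0`: annihilation at
slot `k`, `k < 0`: creation at slot `−k`, `k = 0` or `|k| > d`: identity)
to the basis vector `e_𝔫`. -/
def aIdx (d : ℕ) (k : ℤ) (n : Fin d → ℕ) : Fin d → ℕ :=
  if h : 0 < k ∧ k ≤ (d : ℤ) then
    Function.update n ⟨(k - 1).toNat, by omega⟩ (n ⟨(k - 1).toNat, by omega⟩ - 1)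
  else if h' : 0 < -k ∧ -k ≤ (d : ℤ) then
    Function.update n ⟨(-k - 1).toNat, by omega⟩ (n ⟨(-k - 1).toNat, by omega⟩ + 1)
  else n

/-- The coefficient of `a_k e_𝔫`: `√(n_k)` for `k > 0`, `√(n_{−k}+1)` for
`k < 0`, and `1` for `k = 0`, so that `a_k e_𝔫 = (aCoef k 𝔫) • e_{aIdx k 𝔫}`. -/
def aCoef (d : ℕ) (k : ℤ) (n : Fin d → ℕ) : ℝ :=
  if h : 0 < k ∧ k ≤ (d : ℤ) then Real.sqrt (n ⟨(k - 1).toNat, by omega⟩)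
  else if h' : 0 < -k ∧ -k ≤ (d : ℤ) then Real.sqrt (n ⟨(-k - 1).toNat, by omega⟩ + 1)
  else 1

/-- The multi-index of `x_{kl} e_𝔫`. -/
def xIdx (d : ℕ) (k l : ℤ) (n : Fin d → ℕ) : Fin d → ℕ := aIdx d k (aIdx d l n)

/-- The coefficient of `x_{kl} e_𝔫`, where `x_{kl} = a_k a_l (N+α)⁻¹` if
`k ≥ 0` or `l ≥ 0`, and `x_{kl} = (N+α)⁻¹ a_k a_l` if `k < 0` and `l < 0`. -/
def xCoef (d : ℕ) (α : ℝ) (k l : ℤ) (n : Fin d → ℕ) : ℝ :=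
  if 0 ≤ k ∨ 0 ≤ l then aCoef d k (aIdx d l n) * aCoef d l n / (degIdx d n + α)
  else aCoef d k (aIdx d l n) * aCoef d l n / (degIdx d (xIdx d k l n) + α)

/-- The eigenvalue of `y_m = (N + α + m)⁻¹` on `e_𝔫`. -/
def yCoef (d : ℕ) (α : ℝ) (m : ℤ) (n : Fin d → ℕ) : ℝ :=
  ((degIdx d n : ℝ) + α + m)⁻¹

/-- `xop`, `yop` implement the operators `x_{kl}` and `y_n` of Section 3:
each `x_{kl}` (for `|k|, |l| ≤ d`) acts on basis vectors as the continuous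
extension of `a_k a_l (N+α)⁻¹` resp. `(N+α)⁻¹ a_k a_l`, and each `y_m` acts
diagonally with eigenvalue `(|𝔫|+α+m)⁻¹`. -/
def IsXYSystem (d : ℕ) (α : ℝ) (xop : ℤ → ℤ → BdOp d) (yop : ℤ → BdOp d) : Prop :=
  (∀ k l : ℤ, |k| ≤ (d : ℤ) → |l| ≤ (d : ℤ) → ∀ n : Fin d → ℕ,
    xop k l (e2 d n) = (xCoef d α k l n : ℂ) • e2 d (xIdx d k l n)) ∧
  (∀ m : ℤ, ∀ n : Fin d → ℕ, yop m (e2 d n) = (yCoef d α m n : ℂ) • e2 d n)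

/-- The auxiliary ∗-algebra `X`: the unital subalgebra of `B(ℓ²(ℕ^d))`
generated by the `x_{kl}` (`k, l = −d, …, d`) and the `y_n` (`n ∈ ℕ₀`). -/
def Xalg (d : ℕ) (xop : ℤ → ℤ → BdOp d) (yop : ℤ → BdOp d) :
    Subalgebra ℂ (BdOp d) :=
  Algebra.adjoin ℂ
    ({T | ∃ k l : ℤ, |k| ≤ (d : ℤ) ∧ |l| ≤ (d : ℤ) ∧ T = xop k l} ∪
      {T | ∃ m : ℕ, T = yop m})

/-- `Σ²(X)`: finite sums `Σ_i g_i* g_i` with `g_i ∈ X`. -/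
def XSumSq (d : ℕ) (X : Subalgebra ℂ (BdOp d)) : Set (BdOp d) :=
  {T | ∃ (m : ℕ) (g : Fin m → BdOp d),
    (∀ i, g i ∈ X) ∧ T = ∑ i, star (g i) * g i}

/-- The operator `x^𝔫 = x₁^{n₁} ⋯ x_d^{n_d}`, where `x_k = x_{k0}`. -/
def xPowZ (d : ℕ) (xop : ℤ → ℤ → BdOp d) (n : Fin d → ℕ) : BdOp d :=
  (List.ofFn fun k : Fin d => xop ((k : ℕ) + 1 : ℤ) 0 ^ n k).prod

/-- A ∗-representation of `X` on `H`: a unital ℂ-algebra homomorphism into the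
bounded operators on `H` respecting adjoints (`π(T*) = π(T)*`). -/
def IsStarRep (d : ℕ) (xop : ℤ → ℤ → BdOp d) (yop : ℤ → BdOp d)
    {H : Type*} [NormedAddCommGroup H] [InnerProductSpace ℂ H] [CompleteSpace H]
    (π : ↥(Xalg d xop yop) →ₐ[ℂ] (H →L[ℂ] H)) : Prop :=
  ∀ T U : ↥(Xalg d xop yop), (T : BdOp d) = star (U : BdOp d) → π T = star (π U)

open scoped InnerProductSpace

/-- Bounded operators on `ℓ²(ℕ^d)` that agree on the standard basis are equal. -/
theorem BdOp.ext_e2 {d : ℕ} {S T : BdOp d} (h : ∀ n, S (e2 d n) = T (e2 d n)) : S = T := by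
  refine lp.ext_continuousLinearMap (by simp) fun n => ?_
  refine ContinuousLinearMap.ext_ring ?_
  simpa [e2] using h n

theorem inner_e2_e2 {d : ℕ} (m n : Fin d → ℕ) :
    ⟪e2 d m, e2 d n⟫_ℂ = if m = n then 1 else 0 := by
  rw [e2, lp.inner_single_left, e2, lp.single_apply, Pi.single_apply]
  split_ifs <;> simp

section Ladder

variable {d : ℕ} {α : ℝ} {xop : ℤ → ℤ → BdOp d} {yop : ℤ → BdOp d}

theorem degIdx_update_add_one (j : Fin d) (n : Fin d → ℕ) :
    degIdx d (Function.update n j (n j + 1)) = degIdx d n + 1 := by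
  simp only [degIdx]
  rw [Finset.sum_update_of_mem (Finset.mem_univ j),
    ← Finset.add_sum_erase _ n (Finset.mem_univ j), Finset.sdiff_singleton_eq_erase]
  ring

/-- The action of the annihilation operator `x_{j0}` on basis vectors. -/
theorem IsXYSystem.xop_annihilation_e2 (hxy : IsXYSystem d α xop yop) (j : Fin d)
    (n : Fin d → ℕ) :
    xop ((j : ℕ) + 1) 0 (e2 d n) =
      ((√(n j) / (degIdx d n + α) : ℝ) : ℂ) • e2 d (Function.update n j (n j - 1)) := by
  have hj := j.2
  have hpos : (0 : ℤ) < (j : ℕ) + 1 ∧ ((j : ℕ) + 1 : ℤ) ≤ d := by omega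
  have h := hxy.1 ((j : ℕ) + 1) 0 (abs_le.2 (by omega)) (by simp) n
  simpa [xCoef, xIdx, aIdx, aCoef, hpos] using h

/-- The action of the creation operator `x_{-j,0}` on basis vectors. -/
theorem IsXYSystem.xop_creation_e2 (hxy : IsXYSystem d α xop yop) (j : Fin d)
    (n : Fin d → ℕ) :
    xop (-((j : ℕ) + 1)) 0 (e2 d n) =
      ((√(n j + 1) / (degIdx d n + α) : ℝ) : ℂ) • e2 d (Function.update n j (n j + 1)) := by
  have hj := j.2
  have hneg : ¬ ((0 : ℤ) < -((j : ℕ) + 1) ∧ (-((j : ℕ) + 1) : ℤ) ≤ d) := by omega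
  have hpos : (0 : ℤ) < - -((j : ℕ) + 1) ∧ (- -((j : ℕ) + 1) : ℤ) ≤ d := by omega
  have h := hxy.1 (-((j : ℕ) + 1)) 0 (abs_le.2 (by omega)) (by simp) n
  simp only [xCoef, xIdx, aIdx, aCoef, dif_neg hneg, dif_pos hpos] at h
  simpa using h

/-- The action of `x_{-j,0} (1 - y₁) = (N+α)⁻¹ a_{-j}` on basis vectors. -/
theorem IsXYSystem.creation_mul_e2 (hxy : IsXYSystem d α xop yop) (hα : 0 < α) (j : Fin d)
    (n : Fin d → ℕ) :
    (xop (-((j : ℕ) + 1)) 0 * (1 - yop 1)) (e2 d n) =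
      ((√(n j + 1) / (degIdx d n + α + 1) : ℝ) : ℂ) •
        e2 d (Function.update n j (n j + 1)) := by
  have hy := hxy.2 1 n
  have h0 : (degIdx d n : ℝ) + α ≠ 0 := by positivity
  have h1 : (degIdx d n : ℝ) + α + 1 ≠ 0 := by positivity
  have hc : (√(n j + 1) / (degIdx d n + α) : ℝ) - (degIdx d n + α + 1)⁻¹ *
      (√(n j + 1) / (degIdx d n + α)) = √(n j + 1) / (degIdx d n + α + 1) := by
    field_simp
    ring
  rw [← hc, mul_apply_eq_comp, sub_apply,
    one_apply_eq_self, hy, map_sub, map_smul, hxy.xop_creation_e2, smul_smul,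
    ← sub_smul]
  simp [yCoef]

/-- The adjoint of `x_{j0}` is `x_{-j,0} (1 - y₁)`. -/
theorem IsXYSystem.star_annihilation (hxy : IsXYSystem d α xop yop) (hα : 0 < α) (j : Fin d) :
    xop (-((j : ℕ) + 1)) 0 * (1 - yop 1) = star (xop ((j : ℕ) + 1) 0) := by
  refine BdOp.ext_e2 fun n => ?_
  refine lp.ext (funext fun m => ?_)
  have hcoord : ∀ v : L2 d, v m = ⟪e2 d m, v⟫_ℂ := fun v => by
    rw [e2, lp.inner_single_left]; simp
  rw [hcoord, hcoord, ContinuousLinearMap.star_eq_adjoint,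
    ContinuousLinearMap.adjoint_inner_right, hxy.creation_mul_e2 hα,
    hxy.xop_annihilation_e2, inner_smul_left, inner_smul_right, inner_e2_e2, inner_e2_e2]
  by_cases hm : m = Function.update n j (n j + 1)
  · subst hm
    simp [degIdx_update_add_one, add_right_comm]
  · rw [if_neg hm]
    by_cases hmj : m j = 0
    · simp [hmj]
    · rw [if_neg]
      · simp
      · rintro rfl
        apply hm
        simp [Nat.sub_add_cancel (Nat.one_le_iff_ne_zero.2 hmj)]

/-- The identity `∑ⱼ x_{j0}* x_{j0} = y₀ - α y₀²`. -/
theorem IsXYSystem.sum_star_mul_self (hxy : IsXYSystem d α xop yop) (hα : 0 < α) :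
    ∑ j : Fin d, (xop (-((j : ℕ) + 1)) 0 * (1 - yop 1)) * xop ((j : ℕ) + 1) 0 =
      yop 0 - (α : ℂ) • (yop 0 * yop 0) := by
  refine BdOp.ext_e2 fun n => ?_
  have hterm : ∀ j : Fin d,
      ((xop (-((j : ℕ) + 1)) 0 * (1 - yop 1)) * xop ((j : ℕ) + 1) 0) (e2 d n) =
        ((n j / (degIdx d n + α) ^ 2 : ℝ) : ℂ) • e2 d n := fun j => by
    rw [mul_apply_eq_comp, hxy.xop_annihilation_e2, map_smul,
      hxy.creation_mul_e2 hα, smul_smul]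
    rcases Nat.eq_zero_or_pos (n j) with hj | hj
    · simp [hj]
    · have hn : Function.update (Function.update n j (n j - 1)) j (n j - 1 + 1) = n := by
        simp [Nat.sub_add_cancel hj]
      have hdeg : (degIdx d n : ℝ) = degIdx d (Function.update n j (n j - 1)) + 1 := by
        have := degIdx_update_add_one j (Function.update n j (n j - 1))
        rw [Function.update_self, hn] at this
        exact_mod_cast this
      have hcast : ((n j - 1 : ℕ) : ℝ) + 1 = n j := by
        exact_mod_cast Nat.sub_add_cancel hj
      rw [Function.update_self, hn, hcast, add_right_comm, ← hdeg, ← Complex.ofReal_mul,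
        div_mul_div_comm, Real.mul_self_sqrt (Nat.cast_nonneg _), sq]
  have h0 : (degIdx d n : ℝ) + α ≠ 0 := by positivity
  have hy : yop 0 (e2 d n) = ((((degIdx d n : ℝ) + α)⁻¹ : ℝ) : ℂ) • e2 d n := by
    simpa [yCoef] using hxy.2 0 n
  have hc : ∑ j, (n j / (degIdx d n + α) ^ 2 : ℝ) =
      (degIdx d n + α)⁻¹ - α * ((degIdx d n + α)⁻¹ * (degIdx d n + α)⁻¹) := by
    rw [← Finset.sum_div, ← Nat.cast_sum, ← degIdx]
    field_simp
    ring
  rw [sum_apply, Finset.sum_congr rfl fun j _ => hterm j, ← Finset.sum_smul,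
    ← Complex.ofReal_sum, hc, sub_apply, smul_apply,
    mul_apply_eq_comp, hy, map_smul, hy, smul_smul, smul_smul, ← sub_smul]
  push_cast
  rw [mul_assoc]

end Ladder

/-- Formula (22): in any ∗-representation `π` of `X`, the operator `π(x_{k0})`
vanishes on `ker(π(y₀) − α⁻¹·I)`. -/
theorem stmt12 (d : ℕ) (hd : 1 ≤ d) (α : ℝ) (hα : 0 < α)
    (hαint : ∀ z : ℤ, α ≠ (z : ℝ))
    (xop : ℤ → ℤ → BdOp d) (yop : ℤ → BdOp d) (hxy : IsXYSystem d α xop yop)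
    {H : Type*} [NormedAddCommGroup H] [InnerProductSpace ℂ H] [CompleteSpace H]
    (π : ↥(Xalg d xop yop) →ₐ[ℂ] (H →L[ℂ] H)) (hπ : IsStarRep d xop yop π)
    (k : ℤ) (hk1 : 1 ≤ k) (hkd : k ≤ (d : ℤ))
    (Ty Tx : ↥(Xalg d xop yop))
    (hTy : (Ty : BdOp d) = yop 0) (hTx : (Tx : BdOp d) = xop k 0)
    (φ : H) (hφ : π Ty φ = ((α⁻¹ : ℝ) : ℂ) • φ) :
    π Tx φ = 0 := by
  have hx : ∀ l : ℤ, |l| ≤ (d : ℤ) → xop l 0 ∈ Xalg d xop yop := fun l hl =>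
    Algebra.subset_adjoin (Or.inl ⟨l, 0, hl, by simp, rfl⟩)
  have hy : yop 1 ∈ Xalg d xop yop := Algebra.subset_adjoin (Or.inr ⟨1, rfl⟩)
  let T : Fin d → Xalg d xop yop := fun j =>
    ⟨xop ((j : ℕ) + 1) 0, hx _ (abs_le.2 (by omega))⟩
  let S : Fin d → Xalg d xop yop := fun j =>
    ⟨xop (-((j : ℕ) + 1)) 0, hx _ (abs_le.2 (by omega))⟩ * (1 - ⟨yop 1, hy⟩)
  have hST : ∀ j, π (S j) = star (π (T j)) := fun j => hπ _ _ (hxy.star_annihilation hα j)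
  have hsum : ∑ j, S j * T j = Ty - (α : ℂ) • (Ty * Ty) := by
    apply Subtype.ext
    push_cast [S, T, hTy]
    exact hxy.sum_star_mul_self hα
  have hker : π (∑ j, S j * T j) φ = 0 := by
    have hα' : (α : ℂ) ≠ 0 := by exact_mod_cast hα.ne'
    rw [hsum, map_sub, map_smul, map_mul, sub_apply,
      smul_apply, mul_apply_eq_comp, hφ, map_smul, hφ, smul_smul,
      smul_smul, Complex.ofReal_inv, mul_inv_cancel₀ hα', one_mul, sub_self]
  have hnorm : ∑ j, ‖π (T j) φ‖ ^ 2 = 0 := by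
    have hterm : ∀ j, ((‖π (T j) φ‖ ^ 2 : ℝ) : ℂ) = ⟪φ, π (S j * T j) φ⟫_ℂ := fun j => by
      rw [map_mul, hST, mul_apply_eq_comp, ContinuousLinearMap.star_eq_adjoint,
        ContinuousLinearMap.adjoint_inner_right, inner_self_eq_norm_sq_to_K]
      norm_cast
    apply Complex.ofReal_injective
    rw [Complex.ofReal_sum, Finset.sum_congr rfl fun j _ => hterm j, ← inner_sum,
      ← sum_apply, ← map_sum, hker, inner_zero_right, Complex.ofReal_zero]
  have hzero : ∀ j, π (T j) φ = 0 := fun j => by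
    simpa using (Finset.sum_eq_zero_iff_of_nonneg fun i _ => sq_nonneg ‖π (T i) φ‖).1 hnorm j
      (Finset.mem_univ j)
  have hTxT : Tx = T ⟨(k - 1).toNat, by omega⟩ := by
    apply Subtype.ext
    rw [hTx]
    change xop k 0 = xop (((k - 1).toNat : ℕ) + 1) 0
    congr 1
    omega
  rw [hTxT]
  exact hzero _
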